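/- Let n ≥ 1, let p ≥ 2 be an integer, and let λ, Λ, M > 0. Suppose u : ℝⁿ → ℝ is twice continuously differentiable, satisfies |u(x)| ≤ Λ e^{−λ|x|} for all x ∈ ℝⁿ, and for every j ∈ {1, …, n} the Lᵖ(ℝⁿ) norms of ∂_j u and ∂_j² u are both at most M. Then there exists a constant C > 0, depending only on n, p, λ, Λ and M, such that ∫_{ℝⁿ} e^{λ|x|/2} |∇u(x)|ᵖ dx ≤ C. -/

import Mathlib

open MeasureTheory

/-- The (coordinate-wise) Laplacian of `f : ℝ^m → ℝ` at `x`: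
`∑ i, ∂²f/∂xᵢ²` computed via iterated Fréchet derivatives in coordinate directions. -/
noncomputable def lapl {m : ℕ} (f : EuclideanSpace ℝ (Fin m) → ℝ)
    (x : EuclideanSpace ℝ (Fin m)) : ℝ :=
  ∑ i : Fin m, fderiv ℝ (fun y => fderiv ℝ f y (EuclideanSpace.single i 1)) x
    (EuclideanSpace.single i 1)

/-- `f` is harmonic on the (open) set `U`: it is `C²` on `U` and its Laplacian vanishes on `U`. -/
def HarmonicOnSet {m : ℕ} (f : EuclideanSpace ℝ (Fin m) → ℝ)
    (U : Set (EuclideanSpace ℝ (Fin m))) : Prop :=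
  ContDiffOn ℝ 2 f U ∧ ∀ x ∈ U, lapl f x = 0

/-- The south pole `s = (0, …, 0, -1)` of the unit sphere in `ℝ^{n+1}`. -/
noncomputable def southPole (n : ℕ) : EuclideanSpace ℝ (Fin (n+1)) :=
  -(EuclideanSpace.single (Fin.last n) 1)

/-- The map `Φ(z) = 2 (z - s)/‖z - s‖² + s`. -/
noncomputable def Phi {n : ℕ} (z : EuclideanSpace ℝ (Fin (n+1))) :
    EuclideanSpace ℝ (Fin (n+1)) :=
  (2 / ‖z - southPole n‖ ^ 2) • (z - southPole n) + southPole n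

/-- The Kelvin transform `K[w](z) = 2^{(n-1)/2} ‖z - s‖^{1-n} w(Φ(z))`. -/
noncomputable def kelvin {n : ℕ} (w : EuclideanSpace ℝ (Fin (n+1)) → ℝ)
    (z : EuclideanSpace ℝ (Fin (n+1))) : ℝ :=
  2 ^ (((n : ℝ) - 1) / 2) * ‖z - southPole n‖ ^ ((1 : ℝ) - n) * w (Phi z)

/-- Embed `ℝⁿ` into `ℝ^{n+1}` as the hyperplane `x_{n+1} = 0`. -/
noncomputable def emb {n : ℕ} (x' : EuclideanSpace ℝ (Fin n)) :
    EuclideanSpace ℝ (Fin (n+1)) :=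
  (WithLp.equiv 2 (Fin (n+1) → ℝ)).symm
    (Fin.snoc ((WithLp.equiv 2 (Fin n → ℝ)) x') 0)

/-- The point `(x', t) ∈ ℝ^{n+1}` for `x' ∈ ℝⁿ` and `t ∈ ℝ`. -/
noncomputable def embt {n : ℕ} (x' : EuclideanSpace ℝ (Fin n)) (t : ℝ) :
    EuclideanSpace ℝ (Fin (n+1)) :=
  (WithLp.equiv 2 (Fin (n+1) → ℝ)).symm
    (Fin.snoc ((WithLp.equiv 2 (Fin n → ℝ)) x') t)

/-- The `Lᵖ` norm `(∫_S |f|ᵖ)^{1/p}` of `f` over a set `S` (w.r.t. Lebesgue measure). -/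
noncomputable def LpnormOn {m : ℕ} (f : EuclideanSpace ℝ (Fin m) → ℝ) (p : ℝ)
    (S : Set (EuclideanSpace ℝ (Fin m))) : ℝ :=
  (∫⁻ x in S, ENNReal.ofReal (|f x| ^ p)).toReal ^ (1 / p)

/-- The half ball `B⁺_R(x₀) = {x ∈ ℝ^{n+1} : x_{n+1} > 0, |x - x₀| ≤ R}`. -/
def Bplus {n : ℕ} (x0 : EuclideanSpace ℝ (Fin (n+1))) (R : ℝ) :
    Set (EuclideanSpace ℝ (Fin (n+1))) :=
  {x | 0 < x (Fin.last n) ∧ dist x x0 ≤ R}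

/-- The boundary ball `B'_R(x₀) = {x' ∈ ℝⁿ : |(x', 0) - x₀| ≤ R}`. -/
def Bprime {n : ℕ} (x0 : EuclideanSpace ℝ (Fin (n+1))) (R : ℝ) :
    Set (EuclideanSpace ℝ (Fin n)) :=
  {x' | dist (emb x') x0 ≤ R}

/-- The map `t ↦ t |t|ᵏ` is differentiable everywhere. -/
theorem hasDerivAt_mul_abs_pow (k : ℕ) (t : ℝ) :
    HasDerivAt (fun s : ℝ => s * |s| ^ k) ((k + 1) * |t| ^ k) t := by
  rcases eq_or_ne t 0 with rfl | ht
  · rw [hasDerivAt_iff_tendsto_slope]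
    have h1 : Filter.Tendsto (fun s : ℝ => |s| ^ k) (nhdsWithin 0 {0}ᶜ)
        (nhds (((k : ℝ) + 1) * |0| ^ k)) := by
      have h2 : Continuous fun s : ℝ => |s| ^ k := by fun_prop
      have h3 := h2.tendsto 0
      have h4 : ((k : ℝ) + 1) * |0| ^ k = |0| ^ k := by
        rcases k with _ | k <;> simp
      rw [h4]
      exact h3.mono_left nhdsWithin_le_nhds
    refine h1.congr' ?_
    filter_upwards [self_mem_nhdsWithin] with s hs
    have hs0 : s ≠ 0 := hs
    simp [slope_def_field, hs0]
  · have h := (hasDerivAt_id t).mul ((hasDerivAt_abs ht).pow k)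
    refine (h.congr_deriv ?_)
    rcases k with _ | k
    · simp
    · have h5 : t * (SignType.sign t : ℝ) = |t| := self_mul_sign t
      simp only [id, Nat.add_sub_cancel, Pi.pow_apply]
      push_cast
      rw [pow_succ]
      linear_combination ((k : ℝ) + 1) * |t| ^ k * h5

/-- Exponentials `exp (-c ‖x‖)` with `c > 0` are integrable on finite-dimensional spaces. -/
theorem integrable_exp_neg_mul_norm {E : Type*} [NormedAddCommGroup E] [InnerProductSpace ℝ E]
    [FiniteDimensional ℝ E] [MeasurableSpace E] [BorelSpace E] {c : ℝ} (hc : 0 < c) :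
    Integrable (fun x : E => Real.exp (-c * ‖x‖)) := by
  set m : ℕ := Module.finrank ℝ E + 1 with hm
  have h1 : Integrable (fun x : E => (1 + ‖x‖) ^ (-(m : ℝ))) := by
    apply integrable_one_add_norm
    simp [hm]
  refine (h1.const_mul (Real.exp c * (m.factorial / c ^ m))).mono'
    (by fun_prop) (Filter.Eventually.of_forall fun x => ?_)
  rw [Real.norm_of_nonneg (Real.exp_pos _).le, Real.rpow_neg (by positivity), Real.rpow_natCast]
  have h2 := Real.pow_div_factorial_le_exp (c * (1 + ‖x‖)) (by positivity) m
  have h3 : Real.exp (-c * ‖x‖) = Real.exp c * (Real.exp (c * (1 + ‖x‖)))⁻¹ := by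
    rw [← Real.exp_neg, ← Real.exp_add]; ring_nf
  rw [h3, mul_assoc]
  gcongr
  rw [mul_pow] at h2
  rw [inv_le_comm₀ (Real.exp_pos _) (by positivity)]
  refine le_trans (le_of_eq ?_) h2
  field_simp

theorem pow_mul_le_one_add {a b : ℝ} (ha : 0 ≤ a) (hb : 0 ≤ b) (k : ℕ) :
    a ^ k * b ≤ 1 + a ^ (k + 2) + b ^ (k + 2) := by
  have aux (m : ℝ) (hm : 0 ≤ m) : m ^ (k + 1) ≤ 1 + m ^ (k + 2) := by
    rcases le_total m 1 with h | h
    · exact (pow_le_one₀ hm h).trans (by linarith [pow_nonneg hm (k + 2)])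
    · have := pow_le_pow_right₀ h (show k + 1 ≤ k + 2 by omega)
      linarith
  rcases le_total a b with h | h
  · have : a ^ k * b ≤ b ^ (k + 1) := by rw [pow_succ]; gcongr
    linarith [aux b hb, pow_nonneg ha (k + 2)]
  · have : a ^ k * b ≤ a ^ (k + 1) := by rw [pow_succ]; gcongr
    linarith [aux a ha, pow_nonneg hb (k + 2)]

/-- A bounded smooth approximation (as `ε → 0`) of the weight `exp (c √(1 + ‖x‖²))`. -/
noncomputable def boundedExpWeight {E : Type*} [NormedAddCommGroup E] (c ε : ℝ) (x : E) : ℝ :=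
  (ε + Real.exp (-(c * Real.sqrt (1 + ‖x‖ ^ 2))))⁻¹

section Weight

variable {E : Type*} [NormedAddCommGroup E] {c ε : ℝ}

theorem boundedExpWeight_pos (hε : 0 < ε) (x : E) : 0 < boundedExpWeight c ε x := by
  unfold boundedExpWeight; positivity

theorem boundedExpWeight_le_inv (hε : 0 < ε) (x : E) : boundedExpWeight c ε x ≤ ε⁻¹ := by
  unfold boundedExpWeight
  gcongr
  linarith [Real.exp_pos (-(c * Real.sqrt (1 + ‖x‖ ^ 2)))]

theorem boundedExpWeight_le_exp (hc : 0 < c) (hε : 0 < ε) (x : E) :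
    boundedExpWeight c ε x ≤ Real.exp c * Real.exp (c * ‖x‖) := by
  have h1 : Real.sqrt (1 + ‖x‖ ^ 2) ≤ 1 + ‖x‖ := by
    rw [Real.sqrt_le_left (by positivity)]
    nlinarith [norm_nonneg x]
  calc boundedExpWeight c ε x ≤ (Real.exp (-(c * Real.sqrt (1 + ‖x‖ ^ 2))))⁻¹ := by
        unfold boundedExpWeight
        gcongr
        linarith
    _ = Real.exp (c * Real.sqrt (1 + ‖x‖ ^ 2)) := by rw [Real.exp_neg, inv_inv]
    _ ≤ Real.exp (c * (1 + ‖x‖)) := by gcongr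
    _ = _ := by rw [← Real.exp_add]; ring_nf

theorem continuous_boundedExpWeight (hε : 0 < ε) :
    Continuous (boundedExpWeight c ε : E → ℝ) := by
  unfold boundedExpWeight
  exact Continuous.inv₀ (by fun_prop) fun x => by positivity

theorem tendsto_boundedExpWeight (x : E) :
    Filter.Tendsto (fun m : ℕ => boundedExpWeight c (1 / ((m : ℝ) + 1)) x) Filter.atTop
      (nhds (Real.exp (c * Real.sqrt (1 + ‖x‖ ^ 2)))) := by
  have h := (tendsto_one_div_add_atTop_nhds_zero_nat (𝕜 := ℝ)).add_const
    (Real.exp (-(c * Real.sqrt (1 + ‖x‖ ^ 2))))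
  have h' := h.inv₀ (by positivity)
  rw [zero_add, ← Real.exp_neg, neg_neg] at h'
  exact h'

variable [InnerProductSpace ℝ E]

theorem exists_hasFDerivAt_boundedExpWeight (hc : 0 < c) (hε : 0 < ε) (x : E) :
    ∃ L : E →L[ℝ] ℝ, HasFDerivAt (boundedExpWeight c ε) L x ∧
      ∀ v, ‖v‖ ≤ 1 → |L v| ≤ c * boundedExpWeight c ε x := by
  have h1 : HasFDerivAt (fun y : E => 1 + ‖y‖ ^ 2) (2 • innerSL ℝ x) x :=
    (hasStrictFDerivAt_norm_sq x).hasFDerivAt.const_add 1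
  set s := Real.sqrt (1 + ‖x‖ ^ 2) with hs
  have hspos : 0 < s := by rw [hs]; positivity
  have hxs : ‖x‖ ≤ s := Real.le_sqrt_of_sq_le (by linarith)
  set e := Real.exp (-(c * s)) with he
  have hepos : 0 < e := Real.exp_pos _
  have h2 := (((h1.sqrt (by positivity)).const_mul c).neg.exp).const_add ε
  have h3 := (hasDerivAt_inv (x := ε + e) (by positivity)).comp_hasFDerivAt x h2
  refine ⟨_, h3, fun v hv => ?_⟩
  have hw : boundedExpWeight c ε x = (ε + e)⁻¹ := rfl
  have hin : |inner ℝ x v| ≤ s := by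
    calc |inner ℝ x v| ≤ ‖x‖ * ‖v‖ := abs_real_inner_le_norm x v
      _ ≤ s * 1 := by gcongr
      _ = s := mul_one s
  have heq : ∀ y : ℝ, (-((ε + e) ^ 2)⁻¹) * (e * -(c * (1 / (2 * s) * (2 * y)))) =
      c * (ε + e)⁻¹ * (e / (ε + e)) * (y / s) := by
    intro y; field_simp
  have hex : Real.exp ((-fun y : E => c * Real.sqrt (1 + ‖y‖ ^ 2)) x) = e := rfl
  have hval := heq (inner ℝ x v)
  rw [hw]
  simp only [smul_apply, neg_apply, smul_eq_mul,
    nsmul_eq_mul, innerSL_apply_apply, ← hs, hex, Nat.cast_ofNat]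
  rw [hval, abs_mul, abs_mul, abs_of_pos (show 0 < c * (ε + e)⁻¹ by positivity),
    abs_of_pos (show 0 < e / (ε + e) by positivity), abs_div, abs_of_pos hspos, mul_assoc]
  refine mul_le_of_le_one_right (by positivity) (mul_le_one₀ ?_ (by positivity) ?_)
  · rw [div_le_one (by positivity)]; linarith
  · rwa [div_le_one hspos]

end Weight

theorem integral_norm_pow_le_of_eLpNorm_le {α : Type*} [MeasurableSpace α] {μ : Measure α}
    {f : α → ℝ} {p : ℕ} (hp : p ≠ 0) {M : ℝ} (hM : 0 ≤ M) (hf : AEStronglyMeasurable f μ)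
    (h : eLpNorm f p μ ≤ ENNReal.ofReal M) :
    Integrable (fun x => |f x| ^ p) μ ∧ ∫ x, |f x| ^ p ∂μ ≤ M ^ p := by
  have hmem : MemLp f p μ := ⟨hf, h.trans_lt ENNReal.ofReal_lt_top⟩
  refine ⟨hmem.integrable_norm_pow hp, ?_⟩
  rw [hmem.eLpNorm_eq_integral_rpow_norm (by exact_mod_cast hp) (ENNReal.natCast_ne_top p),
    ENNReal.ofReal_le_ofReal_iff hM] at h
  simp only [ENNReal.toReal_natCast, Real.rpow_natCast, Real.norm_eq_abs] at h
  have h0 : 0 ≤ ∫ x, |f x| ^ p ∂μ := integral_nonneg fun x => by positivity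
  have h1 := pow_le_pow_left₀ (Real.rpow_nonneg h0 _) h p
  rwa [Real.rpow_inv_natCast_pow h0 hp] at h1

section DirectionalDecay

variable {E : Type*} [NormedAddCommGroup E] [InnerProductSpace ℝ E] [FiniteDimensional ℝ E]
  [MeasurableSpace E] [BorelSpace E]

theorem integral_boundedExpWeight_mul_le {c ε A : ℝ} (hc : 0 < c) (hε : 0 < ε) (hA : 0 ≤ A)
    (k : ℕ) {u : E → ℝ} (hu : ContDiff ℝ 2 u)
    (hbound : ∀ x, |u x| ≤ A * Real.exp (-(2 * c) * ‖x‖)) {v : E} (hv : ‖v‖ ≤ 1)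
    (h1 : Integrable (fun x => |fderiv ℝ u x v| ^ (k + 2)))
    (h2 : Integrable (fun x => |fderiv ℝ (fun y => fderiv ℝ u y v) x v| ^ (k + 2))) :
    Integrable (fun x => boundedExpWeight c ε x * |fderiv ℝ u x v| ^ (k + 2)) ∧
    ∫ x, boundedExpWeight c ε x * |fderiv ℝ u x v| ^ (k + 2) ≤
      A * Real.exp c * (c + (k + 1)) * ((∫ x : E, Real.exp (-c * ‖x‖)) +
        2 * (∫ x, |fderiv ℝ u x v| ^ (k + 2)) +
        ∫ x, |fderiv ℝ (fun y => fderiv ℝ u y v) x v| ^ (k + 2)) := by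
  set f : E → ℝ := fun x => fderiv ℝ u x v with hf
  have hfC : ContDiff ℝ 1 f := (hu.fderiv_right (m := 1) (by norm_num)).clm_apply contDiff_const
  have hfcont : Continuous f := hfC.continuous
  have hfdiff : Differentiable ℝ f := hfC.differentiable (by norm_num)
  have hudiff : Differentiable ℝ u := hu.differentiable (by norm_num)
  set W : E → ℝ := boundedExpWeight c ε with hW
  have hWc : Continuous W := continuous_boundedExpWeight hε
  set D : E → ℝ := fun x => Real.exp (-c * ‖x‖) with hD
  have hD1 : ∀ x, D x ≤ 1 := fun x => by
    rw [hD]; exact Real.exp_le_one_iff.2 (by nlinarith [norm_nonneg x])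
  have hD0 : ∀ x, 0 < D x := fun x => Real.exp_pos _
  have hDint : Integrable D := integrable_exp_neg_mul_norm hc
  have hsum : Integrable (fun x => D x + 2 * |f x| ^ (k + 2)) := hDint.add (h1.const_mul 2)
  have huW : ∀ x, |u x| * W x ≤ A * Real.exp c * D x := fun x => by
    calc |u x| * W x ≤ (A * Real.exp (-(2 * c) * ‖x‖)) * (Real.exp c * Real.exp (c * ‖x‖)) :=
          mul_le_mul (hbound x) (boundedExpWeight_le_exp hc hε x)
            (boundedExpWeight_pos hε x).le (by positivity)
      _ = A * Real.exp c * (Real.exp (-(2 * c) * ‖x‖) * Real.exp (c * ‖x‖)) := by ring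
      _ = _ := by rw [← Real.exp_add, hD]; ring_nf
  set g : E → ℝ := fun x => W x * (f x * |f x| ^ k) with hg
  have hgder : ∀ x, ∃ b, |b| ≤ c * W x ∧ HasFDerivAt g (fderiv ℝ g x) x ∧
      fderiv ℝ g x v = b * (f x * |f x| ^ k) +
        W x * ((k + 1) * |f x| ^ k * fderiv ℝ f x v) := fun x => by
    obtain ⟨L, hL, hLv⟩ := exists_hasFDerivAt_boundedExpWeight hc hε x
    have hφ := (hasDerivAt_mul_abs_pow k (f x)).comp_hasFDerivAt x (hfdiff x).hasFDerivAt
    have hprod := hL.mul hφ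
    have hprod' : HasFDerivAt g _ x := hprod
    refine ⟨L v, hLv v hv, hprod'.differentiableAt.hasFDerivAt, ?_⟩
    rw [hprod'.fderiv]
    simp only [add_apply, smul_apply, smul_eq_mul, Function.comp_apply]
    ring
  have hgdiff : Differentiable ℝ g := fun x => by
    obtain ⟨b, -, h, -⟩ := hgder x
    exact h.differentiableAt
  have hgcont : Continuous g := hgdiff.continuous
  set B : E → ℝ := fun x => A * Real.exp c * (c + (k + 1)) *
    (D x + 2 * |f x| ^ (k + 2) + |fderiv ℝ f x v| ^ (k + 2)) with hB
  have hBint : Integrable B := (hsum.add h2).const_mul _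
  have key : ∀ x, |u x * fderiv ℝ g x v| ≤ B x := fun x => by
    obtain ⟨b, hb, -, hbe⟩ := hgder x
    rw [hbe, abs_mul]
    have hWp := boundedExpWeight_pos (c := c) hε x
    have ha := abs_nonneg (f x)
    have hd := abs_nonneg (fderiv ℝ f x v)
    set a := |f x|
    set d := |fderiv ℝ f x v|
    have e1 : |b * (f x * a ^ k) + W x * ((k + 1) * a ^ k * fderiv ℝ f x v)| ≤
        c * W x * (a ^ k * a) + W x * ((k + 1) * (a ^ k * d)) := by
      refine (abs_add_le _ _).trans (add_le_add ?_ (le_of_eq ?_))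
      · rw [abs_mul, abs_mul, abs_of_nonneg (pow_nonneg ha k), mul_comm (|f x|)]
        gcongr
      · rw [abs_mul, abs_of_pos hWp, abs_mul, abs_of_nonneg (by positivity)]
        ring
    have e2 : a ^ k * a ≤ 1 + 2 * a ^ (k + 2) + d ^ (k + 2) := by
      linarith [pow_mul_le_one_add ha ha k, pow_nonneg hd (k + 2)]
    have e3 : a ^ k * d ≤ 1 + 2 * a ^ (k + 2) + d ^ (k + 2) := by
      linarith [pow_mul_le_one_add ha hd k, pow_nonneg ha (k + 2)]
    calc |u x| * _ ≤ |u x| * (c * W x * (a ^ k * a) + W x * ((k + 1) * (a ^ k * d))) := by gcongr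
      _ ≤ |u x| * (c * W x * (1 + 2 * a ^ (k + 2) + d ^ (k + 2)) +
            W x * ((k + 1) * (1 + 2 * a ^ (k + 2) + d ^ (k + 2)))) := by
          have : 0 < W x := hWp
          gcongr
      _ = (|u x| * W x) * ((c + (k + 1)) * (1 + 2 * a ^ (k + 2) + d ^ (k + 2))) := by ring
      _ ≤ (A * Real.exp c * D x) * ((c + (k + 1)) * (1 + 2 * a ^ (k + 2) + d ^ (k + 2))) := by
          exact mul_le_mul_of_nonneg_right (huW x) (by positivity)
      _ = A * Real.exp c * (c + (k + 1)) * (D x + D x * (2 * a ^ (k + 2) + d ^ (k + 2))) := by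
          ring
      _ ≤ A * Real.exp c * (c + (k + 1)) * (D x + 1 * (2 * a ^ (k + 2) + d ^ (k + 2))) := by
          gcongr
          exact hD1 x
      _ = B x := by rw [hB]; ring
  have hfg_eq : ∀ x, fderiv ℝ u x v * g x = W x * |f x| ^ (k + 2) := fun x => by
    change f x * (W x * (f x * |f x| ^ k)) = _
    rw [pow_add, sq_abs]; ring
  have hIW : Integrable (fun x => W x * |f x| ^ (k + 2)) := by
    refine (h1.const_mul ε⁻¹).mono' (by fun_prop) (Filter.Eventually.of_forall fun x => ?_)
    have hWp : 0 < W x := boundedExpWeight_pos (c := c) hε x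
    rw [Real.norm_of_nonneg (by positivity)]
    gcongr
    exact boundedExpWeight_le_inv hε x
  have hIug' : Integrable (fun x => u x * fderiv ℝ g x v) := by
    refine hBint.mono' ?_ (Filter.Eventually.of_forall key)
    exact (hudiff.continuous.measurable.mul
      (measurable_fderiv_apply_const ℝ g v)).aestronglyMeasurable
  have hIug : Integrable (fun x => u x * g x) := by
    refine (hsum.const_mul (A * Real.exp c)).mono'
      (hudiff.continuous.mul hgcont).aestronglyMeasurable (Filter.Eventually.of_forall fun x => ?_)
    have hWp : 0 < W x := boundedExpWeight_pos (c := c) hε x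
    have ha := abs_nonneg (f x)
    calc ‖u x * g x‖ = (|u x| * W x) * (|f x| ^ k * |f x|) := by
          simp only [hg, norm_mul, norm_pow, Real.norm_eq_abs, abs_abs, abs_of_pos hWp]
          ring
      _ ≤ (A * Real.exp c * D x) * (1 + 2 * |f x| ^ (k + 2)) := by
          have := hD0 x
          refine mul_le_mul (huW x) ?_ (by positivity) (by positivity)
          linarith [pow_mul_le_one_add ha ha k]
      _ = A * Real.exp c * (D x + D x * (2 * |f x| ^ (k + 2))) := by ring
      _ ≤ A * Real.exp c * (D x + 1 * (2 * |f x| ^ (k + 2))) := by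
          gcongr
          exact hD1 x
      _ = _ := by rw [one_mul]
  have hparts := integral_mul_fderiv_eq_neg_fderiv_mul_of_integrable (μ := volume)
    (f := u) (g := g) (v := v)
    (by simpa only [hfg_eq] using hIW) hIug' hIug (fun x _ => hudiff x) (fun x _ => hgdiff x)
  simp only [hfg_eq] at hparts
  refine ⟨hIW, ?_⟩
  calc ∫ x, W x * |f x| ^ (k + 2) = -∫ x, u x * fderiv ℝ g x v := by rw [hparts, neg_neg]
    _ ≤ |∫ x, u x * fderiv ℝ g x v| := neg_le_abs _
    _ ≤ ∫ x, |u x * fderiv ℝ g x v| := abs_integral_le_integral_abs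
    _ ≤ ∫ x, B x := integral_mono hIug'.abs hBint key
    _ = _ := by
        simp only [hB]
        rw [integral_const_mul, integral_add hsum h2,
          integral_add hDint (h1.const_mul 2), integral_const_mul]

/-- Weighted decay of a directional derivative, by integration by parts against the bounded
weights `boundedExpWeight` and Fatou's lemma. -/
theorem lintegral_exp_mul_fderiv_pow_le {c A M : ℝ} (hc : 0 < c) (hA : 0 ≤ A) (hM : 0 ≤ M)
    (k : ℕ) {u : E → ℝ} (hu : ContDiff ℝ 2 u)
    (hbound : ∀ x, |u x| ≤ A * Real.exp (-(2 * c) * ‖x‖)) {v : E} (hv : ‖v‖ ≤ 1)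
    (h1 : eLpNorm (fun x => fderiv ℝ u x v) (k + 2 : ℕ) volume ≤ ENNReal.ofReal M)
    (h2 : eLpNorm (fun x => fderiv ℝ (fun y => fderiv ℝ u y v) x v) (k + 2 : ℕ) volume ≤
      ENNReal.ofReal M) :
    ∫⁻ x, ENNReal.ofReal (Real.exp (c * ‖x‖) * |fderiv ℝ u x v| ^ (k + 2)) ≤
      ENNReal.ofReal (A * Real.exp c * (c + (k + 1)) *
        ((∫ x : E, Real.exp (-c * ‖x‖)) + 3 * M ^ (k + 2))) := by
  have hmeas := (measurable_fderiv_apply_const ℝ u v)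
  obtain ⟨i1, b1⟩ := integral_norm_pow_le_of_eLpNorm_le (by omega) hM
    hmeas.aestronglyMeasurable h1
  obtain ⟨i2, b2⟩ := integral_norm_pow_le_of_eLpNorm_le (by omega) hM
    (measurable_fderiv_apply_const ℝ _ v).aestronglyMeasurable h2
  set K := A * Real.exp c * (c + (k + 1)) *
        ((∫ x : E, Real.exp (-c * ‖x‖)) + 3 * M ^ (k + 2)) with hK
  set F : ℕ → E → ENNReal := fun m x => ENNReal.ofReal
    (boundedExpWeight c (1 / ((m : ℝ) + 1)) x * |fderiv ℝ u x v| ^ (k + 2)) with hF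
  have hFm : ∀ m, Measurable (F m) := fun m => by
    have hw := (continuous_boundedExpWeight (E := E) (c := c) (ε := 1 / ((m : ℝ) + 1))
      (by positivity)).measurable
    exact (hw.mul (hmeas.abs.pow_const _)).ennreal_ofReal
  have hFle : ∀ m, ∫⁻ x, F m x ≤ ENNReal.ofReal K := fun m => by
    have hε : (0 : ℝ) < 1 / ((m : ℝ) + 1) := by positivity
    obtain ⟨hi, hb⟩ := integral_boundedExpWeight_mul_le hc hε hA k hu hbound hv i1 i2
    rw [hF, ← ofReal_integral_eq_lintegral_ofReal hi (Filter.Eventually.of_forall fun x =>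
      mul_nonneg (boundedExpWeight_pos hε x).le (by positivity))]
    refine ENNReal.ofReal_le_ofReal (hb.trans ?_)
    rw [hK]
    gcongr ?_ * ?_
    linarith
  calc _ ≤ ∫⁻ x, Filter.liminf (fun m => F m x) Filter.atTop := by
        refine lintegral_mono fun x => ?_
        have ht := (ENNReal.continuous_ofReal.tendsto _).comp
          ((tendsto_boundedExpWeight (c := c) x).mul_const (|fderiv ℝ u x v| ^ (k + 2)))
        have ht' : Filter.liminf (fun m => F m x) Filter.atTop = _ := ht.liminf_eq
        rw [ht']
        refine ENNReal.ofReal_le_ofReal ?_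
        gcongr
        exact Real.le_sqrt_of_sq_le (by linarith)
    _ ≤ Filter.liminf (fun m => ∫⁻ x, F m x) Filter.atTop := lintegral_liminf_le hFm
    _ ≤ Filter.liminf (fun _ : ℕ => ENNReal.ofReal K) Filter.atTop :=
        Filter.liminf_le_liminf (Filter.Eventually.of_forall hFle)
    _ = ENNReal.ofReal K := Filter.liminf_const _

end DirectionalDecay

theorem sqrt_sum_sq_pow_le {ι : Type*} (s : Finset ι) (a : ι → ℝ) (k : ℕ) :
    Real.sqrt (∑ j ∈ s, a j ^ 2) ^ (k + 1) ≤ (s.card : ℝ) ^ k * ∑ j ∈ s, |a j| ^ (k + 1) := by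
  have h1 : Real.sqrt (∑ j ∈ s, a j ^ 2) ≤ ∑ j ∈ s, |a j| := by
    rw [Real.sqrt_le_left (Finset.sum_nonneg fun j _ => abs_nonneg _)]
    simpa only [sq_abs] using
      Finset.sum_sq_le_sq_sum_of_nonneg (s := s) (f := fun j => |a j|) fun j _ => abs_nonneg _
  exact (pow_le_pow_left₀ (Real.sqrt_nonneg _) h1 _).trans
    (pow_sum_le_card_mul_sum_pow (fun j _ => abs_nonneg _) k)

/-- Weighted `Lᵖ` decay of the gradient: if `|u| ≤ Λ e^{−λ|x|}` and all first and second
coordinate partial derivatives of `u` have `Lᵖ` norm at most `M` (`p ≥ 2` an integer), then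
`∫ e^{λ|x|/2} |∇u|ᵖ dx ≤ C` with `C = C(n, p, λ, Λ, M)`. -/
theorem weighted_Lp_gradient_decay (n : ℕ) (hn : 1 ≤ n) (p : ℕ) (hp : 2 ≤ p)
    (lam Lam M : ℝ) (hlam : 0 < lam) (hLam : 0 < Lam) (hM : 0 < M) :
    ∃ C > (0 : ℝ), ∀ u : EuclideanSpace ℝ (Fin n) → ℝ,
      ContDiff ℝ 2 u →
      (∀ x : EuclideanSpace ℝ (Fin n), |u x| ≤ Lam * Real.exp (-lam * ‖x‖)) →
      (∀ j : Fin n,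
        eLpNorm (fun x => fderiv ℝ u x (EuclideanSpace.single j 1))
            (p : ENNReal) volume ≤ ENNReal.ofReal M ∧
        eLpNorm (fun x =>
            fderiv ℝ (fun y => fderiv ℝ u y (EuclideanSpace.single j 1)) x
              (EuclideanSpace.single j 1)) (p : ENNReal) volume ≤ ENNReal.ofReal M) →
      ∫⁻ x, ENNReal.ofReal (Real.exp (lam * ‖x‖ / 2) *
          Real.sqrt (∑ j : Fin n, (fderiv ℝ u x (EuclideanSpace.single j 1)) ^ 2) ^ p) ≤
        ENNReal.ofReal C := by
  obtain ⟨k, rfl⟩ := Nat.exists_eq_add_of_le' hp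
  set K : ℝ := Lam * Real.exp (lam / 2) * (lam / 2 + (k + 1)) *
    ((∫ x : EuclideanSpace ℝ (Fin n), Real.exp (-(lam / 2) * ‖x‖)) + 3 * M ^ (k + 2)) with hK
  have hI : 0 ≤ ∫ x : EuclideanSpace ℝ (Fin n), Real.exp (-(lam / 2) * ‖x‖) :=
    integral_nonneg fun x => (Real.exp_pos _).le
  have hKpos : 0 < K := by positivity
  have hn0 : (0 : ℝ) < n := by exact_mod_cast hn
  refine ⟨(n : ℝ) ^ (k + 1) * (n * K), by positivity, fun u hu hb hd => ?_⟩
  have hj : ∀ j : Fin n, ∫⁻ x, ENNReal.ofReal (Real.exp (lam / 2 * ‖x‖) *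
      |fderiv ℝ u x (EuclideanSpace.single j 1)| ^ (k + 2)) ≤ ENNReal.ofReal K := fun j =>
    lintegral_exp_mul_fderiv_pow_le (by positivity) hLam.le hM.le k hu
      (fun x => by convert hb x using 4; ring) (by simp) (hd j).1 (hd j).2
  have hmeas : ∀ j : Fin n, Measurable fun x => ENNReal.ofReal (Real.exp (lam / 2 * ‖x‖) *
      |fderiv ℝ u x (EuclideanSpace.single j 1)| ^ (k + 2)) := fun j => by
    have h1 := measurable_fderiv_apply_const ℝ u (EuclideanSpace.single j (1 : ℝ))
    have h2 : Measurable fun x : EuclideanSpace ℝ (Fin n) => Real.exp (lam / 2 * ‖x‖) := by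
      fun_prop
    exact (h2.mul (h1.abs.pow_const _)).ennreal_ofReal
  calc _ ≤ ∫⁻ x, ENNReal.ofReal ((n : ℝ) ^ (k + 1)) *
        ∑ j : Fin n, ENNReal.ofReal (Real.exp (lam / 2 * ‖x‖) *
          |fderiv ℝ u x (EuclideanSpace.single j 1)| ^ (k + 2)) := by
        refine lintegral_mono fun x => ?_
        rw [← ENNReal.ofReal_sum_of_nonneg (fun j _ => by positivity),
          ← ENNReal.ofReal_mul (by positivity), ← Finset.mul_sum]
        refine ENNReal.ofReal_le_ofReal ?_
        have h := sqrt_sum_sq_pow_le Finset.univ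
          (fun j : Fin n => fderiv ℝ u x (EuclideanSpace.single j 1)) (k + 1)
        rw [Finset.card_univ, Fintype.card_fin] at h
        rw [mul_left_comm, mul_div_right_comm]
        exact mul_le_mul_of_nonneg_left h (Real.exp_pos _).le
    _ = ENNReal.ofReal ((n : ℝ) ^ (k + 1)) *
        ∑ j : Fin n, ∫⁻ x, ENNReal.ofReal (Real.exp (lam / 2 * ‖x‖) *
          |fderiv ℝ u x (EuclideanSpace.single j 1)| ^ (k + 2)) := by
        rw [lintegral_const_mul _ (Finset.measurable_sum _ fun j _ => hmeas j),
          lintegral_finsetSum _ fun j _ => hmeas j]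
    _ ≤ ENNReal.ofReal ((n : ℝ) ^ (k + 1)) * ∑ _j : Fin n, ENNReal.ofReal K := by
        gcongr with j
        exact hj j
    _ = _ := by
        rw [← ENNReal.ofReal_sum_of_nonneg (fun j _ => hKpos.le),
          ← ENNReal.ofReal_mul (by positivity)]
        simp
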